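/- arXiv:1712.04846 — 2 statements merged into one kernel-verified Lean document; each statement's English description precedes it below -/
import Mathlib

section
/- For every dimension n ≥ 3, there exists no strictly increasing function Ψ: [0,∞) → ℝ such that the mapping F ↦ W(F) = Ψ(‖dev_n log V‖²) is rank-one convex on GL⁺(n), where V = √(FFᵀ). -/
open Matrix Real

attribute [local instance] Matrix.frobeniusNormedAddCommGroup Matrix.frobeniusNormedSpace

noncomputable section

/-- The space of real `n × n` matrices. -/
abbrev Mat (n : ℕ) := Matrix (Fin n) (Fin n) ℝ

/-- `GL⁺(n)`: real `n × n` matrices with positive determinant. -/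
def GLp (n : ℕ) : Set (Mat n) := {F | 0 < F.det}

/-- Frobenius inner product `⟨X, Y⟩ = tr (X Yᵀ)`. -/
def inn {n : ℕ} (X Y : Mat n) : ℝ := (X * Yᵀ).trace

/-- Squared Frobenius norm `‖X‖² = tr (Xᵀ X)`. -/
def nsq {n : ℕ} (X : Mat n) : ℝ := (Xᵀ * X).trace

/-- The primary matrix function associated to `f : ℝ → ℝ`: applies `f` to the eigenvalues
in a spectral decomposition of a Hermitian (i.e. real symmetric) matrix, junk value `0`
otherwise. -/
def matFun {n : ℕ} (f : ℝ → ℝ) (A : Mat n) : Mat n :=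
  if hA : A.IsHermitian then
    (hA.eigenvectorUnitary : Mat n) * Matrix.diagonal (f ∘ hA.eigenvalues) *
      (star (hA.eigenvectorUnitary : Mat n))
  else 0

/-- Principal square root of a symmetric positive semidefinite matrix. -/
def matSqrt {n : ℕ} (A : Mat n) : Mat n := matFun Real.sqrt A

/-- Principal matrix logarithm of a symmetric positive definite matrix. -/
def matLog {n : ℕ} (A : Mat n) : Mat n := matFun Real.log A

/-- `log U` where `U = √(FᵀF)` is the right stretch tensor of `F`. -/
def logU {n : ℕ} (F : Mat n) : Mat n := matLog (matSqrt (Fᵀ * F))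

/-- `log V` where `V = √(FFᵀ)` is the left stretch tensor of `F`. -/
def logV {n : ℕ} (F : Mat n) : Mat n := matLog (matSqrt (F * Fᵀ))

/-- Deviatoric (trace-free) part `dev_n X = X - (tr X / n) 𝟙`. -/
def dev {n : ℕ} (X : Mat n) : Mat n := X - (X.trace / n) • (1 : Mat n)

/-- Rank-one convexity of `W : GL⁺(n) → ℝ`: along every rank-one line segment contained in
`GL⁺(n)`, the function is convex. -/
def RankOneConvex {n : ℕ} (W : Mat n → ℝ) : Prop :=
  ∀ F ∈ GLp n, ∀ ξ η : Fin n → ℝ, ∀ I : Set ℝ, Convex ℝ I →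
    (∀ t ∈ I, 0 < (F + t • vecMulVec ξ η).det) →
    ConvexOn ℝ I (fun t => W (F + t • vecMulVec ξ η))

end

theorem isHermitian_matFun {n : ℕ} (f : ℝ → ℝ) (A : Mat n) : (matFun f A).IsHermitian := by
  unfold matFun
  split_ifs with hA
  · rw [Matrix.star_eq_conjTranspose]
    exact Matrix.isHermitian_mul_mul_conjTranspose _ (Matrix.isHermitian_diagonal _)
  · exact Matrix.isHermitian_zero

theorem roots_charpoly_eq_map_eigenvalues {n : ℕ} {A : Mat n} (hA : A.IsHermitian) :
    A.charpoly.roots = Multiset.map hA.eigenvalues Finset.univ.val := by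
  simpa using hA.roots_charpoly_eq_eigenvalues

theorem roots_charpoly_matFun {n : ℕ} (f : ℝ → ℝ) {A : Mat n} (hA : A.IsHermitian) :
    (matFun f A).charpoly.roots = A.charpoly.roots.map f := by
  have h : (matFun f A).charpoly = (Matrix.diagonal (f ∘ hA.eigenvalues)).charpoly := by
    rw [matFun, dif_pos hA, Matrix.charpoly_mul_comm, ← mul_assoc]
    simp
  rw [h, roots_charpoly_eq_map_eigenvalues hA, Matrix.charpoly_diagonal, Finset.prod_eq_multiset_prod,
    ← Function.comp_def (fun x : ℝ => Polynomial.X - Polynomial.C x), ← Multiset.map_map,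
    Polynomial.roots_multiset_prod_X_sub_C, Multiset.map_map]

theorem trace_eq_sum_roots_charpoly_of_isHermitian {n : ℕ} {A : Mat n} (hA : A.IsHermitian) :
    A.trace = A.charpoly.roots.sum := by
  rw [hA.trace_eq_sum_eigenvalues, roots_charpoly_eq_map_eigenvalues hA]
  rfl

theorem trace_mul_self_eq_sum_roots {n : ℕ} {A : Mat n} (hA : A.IsHermitian) :
    (A * A).trace = (A.charpoly.roots.map (fun x => x ^ 2)).sum := by
  have h : A * A = matFun (fun x => x ^ 2) A := by
    rw [matFun, dif_pos hA]
    conv_lhs => rw [hA.spectral_theorem, ← map_mul, Matrix.diagonal_mul_diagonal]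
    rw [Unitary.conjStarAlgAut_apply]
    simp [Function.comp_def, pow_two]
  rw [h, trace_eq_sum_roots_charpoly_of_isHermitian (isHermitian_matFun _ _), roots_charpoly_matFun _ hA]

theorem nsq_dev_eq {n : ℕ} (hn : n ≠ 0) {A : Mat n} (hA : A.IsHermitian) :
    nsq (dev A) = (A.charpoly.roots.map (fun x => x ^ 2)).sum - A.charpoly.roots.sum ^ 2 / n := by
  have hT : Aᵀ = A := by simpa [Matrix.IsHermitian] using hA
  have hn' : (n : ℝ) ≠ 0 := by exact_mod_cast hn
  rw [← trace_mul_self_eq_sum_roots hA, ← trace_eq_sum_roots_charpoly_of_isHermitian hA]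
  simp only [nsq, dev, Matrix.transpose_sub, Matrix.transpose_smul, Matrix.transpose_one, hT,
    Matrix.sub_mul, Matrix.mul_sub, Matrix.trace_sub, Matrix.smul_mul, Matrix.mul_smul, one_mul,
    mul_one, Matrix.trace_smul, Matrix.trace_one, Fintype.card_fin, smul_eq_mul]
  field_simp
  ring

theorem isHermitian_mul_transpose {n : ℕ} (F : Mat n) : (F * Fᵀ).IsHermitian := by
  simpa using Matrix.isHermitian_mul_conjTranspose_self F

theorem nsq_dev_logV_eq {n : ℕ} (hn : n ≠ 0) (F : Mat n) :
    nsq (dev (logV F)) =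
      ((F * Fᵀ).charpoly.roots.map (fun x => (log (√x)) ^ 2)).sum -
        ((F * Fᵀ).charpoly.roots.map (fun x => log (√x))).sum ^ 2 / n := by
  rw [logV, matLog, nsq_dev_eq hn (isHermitian_matFun _ _),
    roots_charpoly_matFun (A := matSqrt (F * Fᵀ)) _ (isHermitian_matFun _ _), matSqrt,
    roots_charpoly_matFun _ (isHermitian_mul_transpose F)]
  simp [Multiset.map_map]

/-- The block-diagonal matrix with the block `G` followed by `m` diagonal entries `μ`. -/
noncomputable def blockScalarDiag {m : ℕ} (G : Matrix (Fin 2) (Fin 2) ℝ) (μ : ℝ) : Mat (2 + m) :=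
  Matrix.reindex finSumFinEquiv finSumFinEquiv (Matrix.fromBlocks G 0 0 (Matrix.diagonal fun _ => μ))

theorem det_blockScalarDiag {m : ℕ} (G : Matrix (Fin 2) (Fin 2) ℝ) (μ : ℝ) :
    (blockScalarDiag G μ : Mat (2 + m)).det = G.det * μ ^ m := by
  rw [blockScalarDiag, Matrix.det_reindex_self, Matrix.det_fromBlocks_zero₁₂, Matrix.det_diagonal]
  simp

theorem blockScalarDiag_mul_transpose {m : ℕ} (G : Matrix (Fin 2) (Fin 2) ℝ) (μ : ℝ) :
    (blockScalarDiag G μ : Mat (2 + m)) * (blockScalarDiag G μ)ᵀ = blockScalarDiag (G * Gᵀ) (μ ^ 2) := by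
  simp [blockScalarDiag, Matrix.fromBlocks_multiply, Matrix.fromBlocks_transpose, pow_two]

theorem roots_charpoly_blockScalarDiag {m : ℕ} (G : Matrix (Fin 2) (Fin 2) ℝ) (μ a b : ℝ)
    (htr : G.trace = a + b) (hdet : G.det = a * b) :
    (blockScalarDiag G μ : Mat (2 + m)).charpoly.roots = a ::ₘ b ::ₘ Multiset.replicate m μ := by
  have hG : G.charpoly = (Polynomial.X - Polynomial.C a) * (Polynomial.X - Polynomial.C b) := by
    rw [Matrix.charpoly_fin_two, htr, hdet, map_add, map_mul]
    ring
  have h : (blockScalarDiag G μ : Mat (2 + m)).charpoly =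
      ((a ::ₘ b ::ₘ Multiset.replicate m μ).map
        (fun x => Polynomial.X - Polynomial.C x)).prod := by
    rw [blockScalarDiag, Matrix.charpoly_reindex, Matrix.charpoly_fromBlocks_zero₁₂, hG,
      Matrix.charpoly_diagonal]
    simp [mul_assoc]
  rw [h, Polynomial.roots_multiset_prod_X_sub_C]

/-- If the singular values of `G` are `exp (x / 2 ± Q)`, this evaluates `‖dev log V‖²` at
the block-diagonal matrix with blocks `G` and `exp ℓ • 1`. -/
theorem nsq_dev_logV_blockScalarDiag {m : ℕ} (G : Matrix (Fin 2) (Fin 2) ℝ) (x Q ℓ : ℝ)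
    (htr : (G * Gᵀ).trace = exp (x + 2 * Q) + exp (x - 2 * Q))
    (hdet : (G * Gᵀ).det = exp (2 * x)) :
    nsq (dev (logV (blockScalarDiag G (exp ℓ) : Mat (2 + m)))) =
      x ^ 2 / 2 + 2 * Q ^ 2 + m * ℓ ^ 2 - (x + m * ℓ) ^ 2 / (m + 2) := by
  have hdet' : (G * Gᵀ).det = exp (x + 2 * Q) * exp (x - 2 * Q) := by
    rw [hdet, ← exp_add]
    ring_nf
  rw [nsq_dev_logV_eq (by omega), blockScalarDiag_mul_transpose,
    roots_charpoly_blockScalarDiag _ _ _ _ htr hdet']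
  have hs (y : ℝ) : log (√(exp y)) = y / 2 := by rw [log_sqrt (exp_pos y).le, log_exp]
  have hs' : log (√(exp ℓ ^ 2)) = ℓ := by rw [sqrt_sq (exp_pos ℓ).le, log_exp]
  simp only [Multiset.map_cons, Multiset.map_replicate, Multiset.sum_cons, Multiset.sum_replicate,
    hs, hs', nsmul_eq_mul]
  push_cast
  ring

/-- Embedding of `ℝ²` in `ℝ^(2 + m)` as the first two coordinates. -/
def embedVec {m : ℕ} (v : Fin 2 → ℝ) : Fin (2 + m) → ℝ := Sum.elim v 0 ∘ finSumFinEquiv.symm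

theorem blockScalarDiag_add_smul_vecMulVec {m : ℕ} (G : Matrix (Fin 2) (Fin 2) ℝ) (μ s : ℝ)
    (ξ η : Fin 2 → ℝ) :
    (blockScalarDiag G μ : Mat (2 + m)) + s • vecMulVec (embedVec ξ) (embedVec η) =
      blockScalarDiag (G + s • vecMulVec ξ η) μ := by
  ext i j
  obtain ⟨i, rfl⟩ := finSumFinEquiv.surjective i
  obtain ⟨j, rfl⟩ := finSumFinEquiv.surjective j
  simp only [blockScalarDiag, embedVec, Matrix.add_apply, Matrix.smul_apply, Matrix.reindex_apply,
    Matrix.submatrix_apply, Equiv.symm_apply_apply, vecMulVec_apply, Function.comp_apply]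
  rcases i with i | i <;> rcases j with j | j <;> simp [vecMulVec_apply]

theorem one_add_smul_vecMulVec (s k : ℝ) :
    (1 : Matrix (Fin 2) (Fin 2) ℝ) + s • vecMulVec ![1, k] ![1, 0] = !![1 + s, 0; s * k, 1] := by
  ext i j
  fin_cases i <;> fin_cases j <;> simp

theorem trace_one_add_shear (s k : ℝ) :
    (!![1 + s, 0; s * k, 1] * !![1 + s, 0; s * k, 1]ᵀ).trace =
      2 * (1 + s) + s ^ 2 * (1 + k ^ 2) := by
  simp only [Matrix.trace_fin_two, Matrix.mul_apply, Matrix.transpose_apply, Fin.sum_univ_two]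
  simp
  ring

theorem det_one_add_shear (s k : ℝ) :
    (!![1 + s, 0; s * k, 1] * !![1 + s, 0; s * k, 1]ᵀ).det = (1 + s) ^ 2 := by
  rw [Matrix.det_mul, Matrix.det_transpose, Matrix.det_fin_two_of]
  ring

/-- The value of `‖dev log V‖²` along a rank-one line through a diagonal matrix. -/
theorem nsq_dev_logV_rank_one_line {m : ℕ} (s k Q ℓ : ℝ) (hs : 0 < 1 + s)
    (hQ : 4 * (1 + s) * sinh Q ^ 2 = s ^ 2 * (1 + k ^ 2)) :
    nsq (dev (logV ((blockScalarDiag 1 (exp ℓ) : Mat (2 + m)) +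
        s • vecMulVec (embedVec ![1, k]) (embedVec ![1, 0])))) =
      log (1 + s) ^ 2 / 2 + 2 * Q ^ 2 + m * ℓ ^ 2 - (log (1 + s) + m * ℓ) ^ 2 / (m + 2) := by
  rw [blockScalarDiag_add_smul_vecMulVec, one_add_smul_vecMulVec]
  refine nsq_dev_logV_blockScalarDiag _ _ _ _ ?_ ?_
  · rw [trace_one_add_shear, ← hQ, exp_add, exp_sub, exp_log hs, sinh_eq]
    have h2 : exp (2 * Q) = exp Q ^ 2 := by rw [← exp_nat_mul]; norm_num
    rw [h2, exp_neg]
    have := (exp_pos Q).ne'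
    field_simp
    ring
  · rw [det_one_add_shear, two_mul, exp_add, exp_log hs]
    ring

theorem five_halves_mul_sinh_three_le : 5 / 2 * sinh 3 ≤ sinh 4 := by
  have h : sinh 4 = sinh 3 * cosh 1 + cosh 3 * sinh 1 := by rw [← sinh_add]; norm_num
  have h1 : sinh 3 ≤ cosh 3 := (sinh_lt_cosh 3).le
  have h2 : 0 ≤ sinh 1 := sinh_nonneg_iff.2 zero_le_one
  have h3 : cosh 1 + sinh 1 = exp 1 := cosh_add_sinh 1
  have h4 : 0 ≤ sinh 3 := sinh_nonneg_iff.2 (by norm_num)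
  have h5 := exp_one_gt_d9
  nlinarith [mul_le_mul_of_nonneg_right h1 h2]

/-- **Proposition 5.2.** For every `n ≥ 3` there is no strictly increasing
`Ψ : [0,∞) → ℝ` such that `F ↦ Ψ(‖dev_n log V‖²)` (with `V = √(FFᵀ)`) is rank-one convex
on `GL⁺(n)`. -/
theorem no_rank_one_convex_function_of_devLogV
    (n : ℕ) (hn : 3 ≤ n) :
    ¬ ∃ Ψ : ℝ → ℝ, StrictMonoOn Ψ (Set.Ici 0) ∧
      RankOneConvex (fun F : Mat n => Ψ (nsq (dev (logV F)))) := by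
  rintro ⟨Ψ, hΨ, hconv⟩
  obtain ⟨m, rfl⟩ : ∃ m, n = 2 + m := ⟨n - 2, by omega⟩
  have hm : (1 : ℝ) ≤ m := by exact_mod_cast (by omega : 1 ≤ m)
  have hsinh : 3 ≤ sinh 3 := self_le_sinh_iff.2 (by norm_num)
  set k : ℝ := √(16 * sinh 3 ^ 2 / 9 - 1) with hk
  have hk2 : 1 + k ^ 2 = 16 * sinh 3 ^ 2 / 9 := by
    rw [hk, sq_sqrt (by nlinarith)]
    ring
  set Q : ℝ := arsinh (5 / 2 * sinh 3) with hQdef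
  have hQ : sinh Q = 5 / 2 * sinh 3 := sinh_arsinh _
  have hQ4 : Q ≤ 4 := by
    rw [← sinh_le_sinh, hQ]
    exact five_halves_mul_sinh_three_le
  have hQ0 : 0 ≤ Q := arsinh_nonneg_iff.2 (by linarith)
  set x : ℝ := log 4 with hx
  have hx' : x = 2 * log 2 := by
    rw [hx, show (4 : ℝ) = 2 ^ 2 by norm_num, log_pow]
    norm_num
  have hx16 : log 16 = 2 * x := by
    rw [hx, show (16 : ℝ) = 4 ^ 2 by norm_num, log_pow]
    norm_num
  have hx0 : 0 < x := log_pos (by norm_num)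
  have hx1 : x ≤ 7 / 5 := by linarith [log_two_lt_d9]
  -- `ℓ` is chosen such that `‖dev log V‖²` takes the same value at `s = 0` and `s = 15`.
  set ℓ : ℝ := (m + 2) * (2 * x ^ 2 + 2 * Q ^ 2 - 4 * x ^ 2 / (m + 2)) / (4 * x * m) with hℓ
  set F : Mat (2 + m) := blockScalarDiag 1 (exp ℓ) with hF
  have hdet (s : ℝ) (hs : 0 ≤ s) :
      0 < (F + s • vecMulVec (embedVec ![1, k]) (embedVec ![1, 0])).det := by
    rw [hF, blockScalarDiag_add_smul_vecMulVec, one_add_smul_vecMulVec, det_blockScalarDiag,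
      Matrix.det_fin_two_of]
    have := exp_pos ℓ
    have : 0 < (1 + s) * 1 - 0 * (s * k) := by linarith
    positivity
  have hF0 : F ∈ GLp (2 + m) := by simpa [GLp] using hdet 0 le_rfl
  have hcon := hconv F hF0 (embedVec ![1, k]) (embedVec ![1, 0]) (Set.Ici 0) (convex_Ici 0)
    (fun s hs => hdet s hs)
  have hc := hcon.2 (Set.mem_Ici.2 (le_refl (0 : ℝ))) (Set.mem_Ici.2 (by norm_num : (0 : ℝ) ≤ 15))
    (by norm_num : (0 : ℝ) ≤ 4 / 5) (by norm_num : (0 : ℝ) ≤ 1 / 5) (by norm_num)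
  have e0 := nsq_dev_logV_rank_one_line (m := m) 0 k 0 ℓ (by norm_num) (by simp)
  have e3 := nsq_dev_logV_rank_one_line (m := m) 3 k 3 ℓ (by norm_num) (by rw [hk2]; ring)
  have e15 := nsq_dev_logV_rank_one_line (m := m) 15 k Q ℓ (by norm_num) (by rw [hk2, hQ]; ring)
  have hmid : (4 / 5 : ℝ) * 0 + 1 / 5 * 15 = 3 := by norm_num
  rw [← hF] at e0 e3 e15
  simp only [hmid, e0, e3, e15, smul_eq_mul] at hc
  rw [show (1 : ℝ) + 0 = 1 by norm_num, log_one, show (1 : ℝ) + 3 = 4 by norm_num, ← hx,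
    show (1 : ℝ) + 15 = 16 by norm_num, hx16] at hc
  have hm0 : (m : ℝ) ≠ 0 := by positivity
  have h15 : (2 * x) ^ 2 / 2 + 2 * Q ^ 2 + m * ℓ ^ 2 - (2 * x + m * ℓ) ^ 2 / (m + 2) =
      0 ^ 2 / 2 + 2 * 0 ^ 2 + m * ℓ ^ 2 - (0 + m * ℓ) ^ 2 / (m + 2) := by
    have hℓ' : 4 * x * m * ℓ = (m + 2) * (2 * x ^ 2 + 2 * Q ^ 2) - 4 * x ^ 2 := by
      rw [hℓ]
      field_simp
    field_simp
    linear_combination -2 * hℓ'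
  have h3 : 0 ^ 2 / 2 + 2 * 0 ^ 2 + m * ℓ ^ 2 - (0 + m * ℓ) ^ 2 / (m + 2) <
      x ^ 2 / 2 + 2 * 3 ^ 2 + m * ℓ ^ 2 - (x + m * ℓ) ^ 2 / (m + 2) := by
    have hx2 : 0 ≤ x ^ 2 / (m + 2) := by positivity
    have e : x ^ 2 / 2 + 2 * 3 ^ 2 + m * ℓ ^ 2 - (x + m * ℓ) ^ 2 / (m + 2) -
        (0 ^ 2 / 2 + 2 * 0 ^ 2 + m * ℓ ^ 2 - (0 + m * ℓ) ^ 2 / (m + 2)) =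
        18 - x ^ 2 / 2 + x ^ 2 / (m + 2) - Q ^ 2 := by
      linear_combination (1 / 2 : ℝ) * h15
    nlinarith
  have h0 : 0 ≤ 0 ^ 2 / 2 + 2 * 0 ^ 2 + m * ℓ ^ 2 - (0 + m * ℓ) ^ 2 / (m + 2) := by
    have e : 0 ^ 2 / 2 + 2 * 0 ^ 2 + m * ℓ ^ 2 - (0 + m * ℓ) ^ 2 / (m + 2) =
        2 * m * ℓ ^ 2 / (m + 2) := by
      field_simp
      ring
    rw [e]
    positivity
  rw [h15] at hc
  linarith [hΨ h0 (h0.trans h3.le) h3]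
end

section
/- Let Ψ: [0,∞) → ℝ be twice continuously differentiable and define W: GL⁺(2) → ℝ by W(F) = Ψ(‖dev₂ log U‖²), where U = √(FᵀF). Then the following are equivalent: (i) W is polyconvex; (ii) W is rank-one convex; (iii) 2η·Ψ''(η) + (1 − √(2η))·Ψ'(η) ≥ 0 for all η ∈ (0,∞). -/
open Matrix Real

attribute [local instance] Matrix.frobeniusNormedAddCommGroup Matrix.frobeniusNormedSpace

/-- Polyconvexity in dimension 2: `W(F) = P(F, det F)` for a convex `P` with values in
`ℝ ∪ {+∞}`. -/
def Polyconvex2 (W : Mat 2 → ℝ) : Prop :=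
  ∃ P : Mat 2 × ℝ → EReal,
    (∀ X Y : Mat 2 × ℝ, ∀ a b : ℝ, 0 ≤ a → 0 ≤ b → a + b = 1 →
      P (a • X + b • Y) ≤ ((a : ℝ) : EReal) * P X + ((b : ℝ) : EReal) * P Y) ∧
    (∀ F ∈ GLp 2, (W F : EReal) = P (F, F.det))

section MatFun

variable {n : ℕ}

theorem matFun_isHermitian (f : ℝ → ℝ) (A : Mat n) : (matFun f A).IsHermitian := by
  unfold matFun
  split_ifs with hA
  · rw [star_eq_conjTranspose]
    exact isHermitian_mul_mul_conjTranspose _ (isHermitian_diagonal _)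
  · exact isHermitian_zero

theorem trace_matFun (f : ℝ → ℝ) {A : Mat n} (hA : A.IsHermitian) :
    (matFun f A).trace = ∑ i, f (hA.eigenvalues i) := by
  rw [matFun, dif_pos hA, trace_mul_cycle, Unitary.coe_star_mul_self, one_mul, trace_diagonal]
  rfl

theorem det_matFun (f : ℝ → ℝ) {A : Mat n} (hA : A.IsHermitian) :
    (matFun f A).det = ∏ i, f (hA.eigenvalues i) := by
  rw [matFun, dif_pos hA, det_mul_right_comm,
    Unitary.mul_star_self_of_mem hA.eigenvectorUnitary.2, one_mul, det_diagonal]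
  rfl

theorem nsq_matFun (f : ℝ → ℝ) {A : Mat n} (hA : A.IsHermitian) :
    nsq (matFun f A) = ∑ i, f (hA.eigenvalues i) ^ 2 := by
  have hT : (matFun f A)ᵀ = matFun f A := by
    simpa [conjTranspose_eq_transpose_of_trivial] using (matFun_isHermitian f A).eq
  have hU := Unitary.coe_star_mul_self hA.eigenvectorUnitary
  rw [nsq, hT, matFun, dif_pos hA]
  have key : ∀ U D V : Mat n, V * U = 1 → U * D * V * (U * D * V) = U * (D * D) * V := by
    intro U D V h
    calc U * D * V * (U * D * V) = U * D * (V * U) * D * V := by simp only [Matrix.mul_assoc]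
      _ = _ := by rw [h]; simp only [Matrix.mul_assoc, Matrix.mul_one]
  rw [key _ _ _ hU, trace_mul_cycle, hU, one_mul, diagonal_mul_diagonal, trace_diagonal]
  simp [sq]

end MatFun

theorem nsq_dev (X : Mat 2) : nsq (dev X) = nsq X - X.trace ^ 2 / 2 := by
  simp [nsq, dev, Matrix.trace, Matrix.mul_apply, Fin.sum_univ_two]
  ring

/-- The sum of the singular values of `F`, when `F` has nonnegative determinant. -/
noncomputable def singSum (F : Mat 2) : ℝ := ‖(⟨F 0 0 + F 1 1, F 1 0 - F 0 1⟩ : ℂ)‖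

/-- The difference of the singular values of `F`, when `F` has nonnegative determinant. -/
noncomputable def singDiff (F : Mat 2) : ℝ := ‖(⟨F 0 0 - F 1 1, F 1 0 + F 0 1⟩ : ℂ)‖

/-- The largest singular value of `F`. -/
noncomputable def singMax (F : Mat 2) : ℝ := (singSum F + singDiff F) / 2

theorem singSum_nonneg (F : Mat 2) : 0 ≤ singSum F := norm_nonneg _

theorem singDiff_nonneg (F : Mat 2) : 0 ≤ singDiff F := norm_nonneg _

theorem singMax_nonneg (F : Mat 2) : 0 ≤ singMax F := by
  have := singSum_nonneg F
  have := singDiff_nonneg F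
  unfold singMax
  positivity

theorem singSum_sq (F : Mat 2) : singSum F ^ 2 = nsq F + 2 * F.det := by
  rw [singSum, ← Complex.normSq_eq_norm_sq, Complex.normSq_mk, det_fin_two]
  simp [nsq, Matrix.trace, Matrix.mul_apply, Fin.sum_univ_two]
  ring

theorem singDiff_sq (F : Mat 2) : singDiff F ^ 2 = nsq F - 2 * F.det := by
  rw [singDiff, ← Complex.normSq_eq_norm_sq, Complex.normSq_mk, det_fin_two]
  simp [nsq, Matrix.trace, Matrix.mul_apply, Fin.sum_univ_two]
  ring

theorem singMax_combo_le (F G : Mat 2) {a b : ℝ} (ha : 0 ≤ a) (hb : 0 ≤ b) :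
    singMax (a • F + b • G) ≤ a * singMax F + b * singMax G := by
  have key : ∀ z w : ℂ, ‖(a : ℂ) * z + b * w‖ ≤ a * ‖z‖ + b * ‖w‖ := by
    intro z w
    refine (norm_add_le _ _).trans_eq ?_
    rw [norm_mul, norm_mul, Complex.norm_of_nonneg ha, Complex.norm_of_nonneg hb]
  have h1 : singSum (a • F + b • G) ≤ a * singSum F + b * singSum G := by
    refine Eq.trans_le ?_ (key _ _)
    unfold singSum
    congr 1
    apply Complex.ext <;> simp <;> ring
  have h2 : singDiff (a • F + b • G) ≤ a * singDiff F + b * singDiff G := by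
    refine Eq.trans_le ?_ (key _ _)
    unfold singDiff
    congr 1
    apply Complex.ext <;> simp <;> ring
  unfold singMax
  linarith

theorem det_le_singMax_sq (F : Mat 2) : F.det ≤ singMax F ^ 2 := by
  have := singSum_nonneg F
  have := singDiff_nonneg F
  have := singSum_sq F
  have := singDiff_sq F
  unfold singMax
  nlinarith [mul_nonneg (singSum_nonneg F) (singDiff_nonneg F), sq_nonneg (singDiff F)]

theorem nsq_dev_logU {F : Mat 2} (hF : 0 < F.det) :
    nsq (dev (logU F)) = log (singMax F ^ 2 / F.det) ^ 2 / 2 := by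
  have hA : (Fᵀ * F).PosSemidef := by
    simpa [conjTranspose_eq_transpose_of_trivial] using posSemidef_conjTranspose_mul_self F
  have hB : (matSqrt (Fᵀ * F)).IsHermitian := matFun_isHermitian _ _
  set e := hA.isHermitian.eigenvalues with he
  set μ := hB.eigenvalues with hμ
  have he0 : 0 ≤ e 0 := hA.eigenvalues_nonneg 0
  have he1 : 0 ≤ e 1 := hA.eigenvalues_nonneg 1
  have htrA : nsq F = e 0 + e 1 := by
    have := hA.isHermitian.trace_eq_sum_eigenvalues
    simpa [Fin.sum_univ_two, nsq] using this
  have hdetA : F.det ^ 2 = e 0 * e 1 := by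
    have := hA.isHermitian.det_eq_prod_eigenvalues
    simpa [Fin.prod_univ_two, det_mul, sq] using this
  have htrB : μ 0 + μ 1 = √(e 0) + √(e 1) := by
    have := hB.trace_eq_sum_eigenvalues.symm.trans (trace_matFun _ hA.isHermitian)
    simpa [Fin.sum_univ_two] using this
  have hdetB : μ 0 * μ 1 = F.det := by
    have := hB.det_eq_prod_eigenvalues.symm.trans (det_matFun _ hA.isHermitian)
    have h2 : μ 0 * μ 1 = √(e 0) * √(e 1) := by simpa [Fin.prod_univ_two] using this
    rw [h2, ← Real.sqrt_mul he0, ← hdetA, Real.sqrt_sq hF.le]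
  have hμsum : μ 0 + μ 1 = singSum F := by
    have h0 : 0 ≤ μ 0 + μ 1 := by rw [htrB]; positivity
    rw [← sq_eq_sq₀ h0 (singSum_nonneg F), singSum_sq, htrA, ← Real.sqrt_sq hF.le, hdetA,
      Real.sqrt_mul he0, htrB, add_sq, Real.sq_sqrt he0, Real.sq_sqrt he1]
    ring
  have hμdiff : (μ 0 - μ 1) ^ 2 = singDiff F ^ 2 := by
    have h1 := singSum_sq F
    have h2 := singDiff_sq F
    rw [← hμsum] at h1
    nlinarith
  have hN : nsq (dev (logU F)) = (log (μ 0) - log (μ 1)) ^ 2 / 2 := by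
    rw [nsq_dev, logU, matLog, trace_matFun _ hB, nsq_matFun _ hB]
    simp only [Fin.sum_univ_two]
    ring
  have hpos : 0 < μ 0 ∧ 0 < μ 1 := by
    have := singSum_nonneg F
    constructor <;> nlinarith
  have hlog : ∀ x y : ℝ, 0 < x → 0 < y → x * y = F.det →
      log x - log y = log (x ^ 2 / F.det) := by
    intro x y hx hy hxy
    rw [← Real.log_div hx.ne' hy.ne', ← hxy]
    congr 1
    field_simp
  rw [hN]
  rcases sq_eq_sq_iff_eq_or_eq_neg.1 hμdiff with h | h
  · have : singMax F = μ 0 := by unfold singMax; linarith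
    rw [this, hlog _ _ hpos.1 hpos.2 hdetB]
  · have : singMax F = μ 1 := by unfold singMax; linarith
    rw [this, ← hlog _ _ hpos.2 hpos.1 (by rw [mul_comm, hdetB])]
    ring

theorem add_sq_div_add_le {a b n k δ ε : ℝ} (ha : 0 ≤ a) (hb : 0 ≤ b) (hδ : 0 < δ) (hε : 0 < ε)
    (hpos : 0 < a * δ + b * ε) :
    (a * n + b * k) ^ 2 / (a * δ + b * ε) ≤ a * (n ^ 2 / δ) + b * (k ^ 2 / ε) := by
  obtain ⟨p, rfl⟩ : ∃ p, n = p * δ := ⟨n / δ, by field_simp⟩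
  obtain ⟨q, rfl⟩ : ∃ q, k = q * ε := ⟨k / ε, by field_simp⟩
  have h1 : (p * δ) ^ 2 / δ = p ^ 2 * δ := by field_simp
  have h2 : (q * ε) ^ 2 / ε = q ^ 2 * ε := by field_simp
  rw [div_le_iff₀ hpos, h1, h2]
  have : 0 ≤ a * δ * (b * ε) * (p - q) ^ 2 := by positivity
  nlinarith

theorem det_fin_two_add_smul_vecMulVec (F : Mat 2) (ξ η : Fin 2 → ℝ) (t : ℝ) :
    (F + t • vecMulVec ξ η).det =
      F.det + t * (ξ 0 * η 0 * F 1 1 + ξ 1 * η 1 * F 0 0 - ξ 0 * η 1 * F 1 0 -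
        ξ 1 * η 0 * F 0 1) := by
  simp [det_fin_two, vecMulVec_apply]
  ring

theorem Polyconvex2.rankOneConvex {W : Mat 2 → ℝ} (hW : Polyconvex2 W) : RankOneConvex W := by
  obtain ⟨P, hP, hPW⟩ := hW
  intro F _ ξ η I hI hdet
  refine ⟨hI, fun s hs t ht a b ha hb hab => ?_⟩
  have h := hP (F + s • vecMulVec ξ η, (F + s • vecMulVec ξ η).det)
    (F + t • vecMulVec ξ η, (F + t • vecMulVec ξ η).det) a b ha hb hab
  rw [← hPW _ (hdet s hs), ← hPW _ (hdet t ht)] at h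
  have hb' : b = 1 - a := by linarith
  have hpt : a • (F + s • vecMulVec ξ η, (F + s • vecMulVec ξ η).det) +
      b • (F + t • vecMulVec ξ η, (F + t • vecMulVec ξ η).det) =
      (F + (a • s + b • t) • vecMulVec ξ η, (F + (a • s + b • t) • vecMulVec ξ η).det) := by
    subst hb'
    refine Prod.ext ?_ ?_
    · ext i j
      simp
      ring
    · simp only [Prod.snd_add, Prod.smul_snd, det_fin_two_add_smul_vecMulVec, smul_eq_mul]
      ring
  rw [hpt, ← hPW _ (hdet _ (hI hs ht ha hb hab))] at h
  exact_mod_cast h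

/-- A convex nondecreasing function of the ratio of the singular values is polyconvex. -/
theorem polyconvex2_of_convexOn {W : Mat 2 → ℝ} {h : ℝ → ℝ} (hc : ConvexOn ℝ (Set.Ici 1) h)
    (hm : MonotoneOn h (Set.Ici 1)) (hW : ∀ F ∈ GLp 2, W F = h (singMax F ^ 2 / F.det)) :
    Polyconvex2 W := by
  refine ⟨fun X => if 0 < X.2 then ((h (max 1 (singMax X.1 ^ 2 / X.2)) : ℝ) : EReal) else ⊤,
    fun X Y a b ha hb hab => ?_, fun F hF => ?_⟩
  · rcases ha.eq_or_lt with rfl | ha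
    · obtain rfl : b = 1 := by linarith
      simp
    rcases hb.eq_or_lt with rfl | hb
    · obtain rfl : a = 1 := by linarith
      simp
    by_cases hX : 0 < X.2
    · by_cases hY : 0 < Y.2
      · have hpos : 0 < a * X.2 + b * Y.2 := by positivity
        simp only [Prod.snd_add, Prod.smul_snd, Prod.fst_add, Prod.smul_fst, smul_eq_mul, hX, hY,
          hpos, if_true]
        norm_cast
        have hmem : ∀ y : ℝ, max 1 y ∈ Set.Ici (1 : ℝ) := fun y => le_max_left 1 y
        have hcomb := hc.1 (hmem (singMax X.1 ^ 2 / X.2)) (hmem (singMax Y.1 ^ 2 / Y.2))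
          ha.le hb.le hab
        refine le_trans (hm (hmem _) hcomb (max_le hcomb ?_))
          (hc.2 (hmem _) (hmem _) ha.le hb.le hab)
        calc singMax (a • X.1 + b • Y.1) ^ 2 / (a * X.2 + b * Y.2)
              ≤ (a * singMax X.1 + b * singMax Y.1) ^ 2 / (a * X.2 + b * Y.2) := by
                gcongr
                · exact singMax_nonneg _
                · exact singMax_combo_le _ _ ha.le hb.le
            _ ≤ a * (singMax X.1 ^ 2 / X.2) + b * (singMax Y.1 ^ 2 / Y.2) :=
                add_sq_div_add_le ha.le hb.le hX hY hpos
            _ ≤ _ := by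
                simp only [smul_eq_mul]
                gcongr <;> exact le_max_right _ _
      · simp only [hX, hY, if_true, if_false, EReal.coe_mul_top_of_pos hb]
        rw [← EReal.coe_mul, EReal.coe_add_top]
        exact le_top
    · simp only [hX, if_false, EReal.coe_mul_top_of_pos ha]
      split_ifs
      all_goals first
        | (rw [EReal.coe_mul_top_of_pos hb]; exact le_top)
        | (rw [← EReal.coe_mul, EReal.top_add_coe]; exact le_top)
        | exact le_top
  · have h1 : 1 ≤ singMax F ^ 2 / F.det := (one_le_div hF).2 (det_le_singMax_sq F)
    simp only [hW F hF, max_eq_right h1]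
    exact (if_pos hF).symm

theorem hasDerivAt_log_sq_div_two {x : ℝ} (hx : x ≠ 0) :
    HasDerivAt (fun x => log x ^ 2 / 2) (log x / x) x := by
  refine (((Real.hasDerivAt_log hx).pow 2).div_const 2).congr_deriv ?_
  simp only [Nat.cast_ofNat, Nat.add_one_sub_one, pow_one]
  field_simp

section Scalar

variable {Ψ : ℝ → ℝ}

theorem hasDerivAt_comp_log_sq (hΨ : ContDiffOn ℝ 2 Ψ (Set.Ici 0)) {x : ℝ} (hx : 1 < x) :
    HasDerivAt (fun x => Ψ (log x ^ 2 / 2)) (deriv Ψ (log x ^ 2 / 2) * (log x / x)) x := by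
  have hs : 0 < log x ^ 2 / 2 := by have := Real.log_pos hx; positivity
  have h1 : HasDerivAt Ψ (deriv Ψ (log x ^ 2 / 2)) (log x ^ 2 / 2) :=
    ((hΨ.contDiffAt (Ici_mem_nhds hs)).differentiableAt (by norm_num)).hasDerivAt
  have h2 := hasDerivAt_log_sq_div_two (by positivity : x ≠ 0)
  exact h1.comp x h2

theorem hasDerivAt_deriv_comp_log_sq (hΨ : ContDiffOn ℝ 2 Ψ (Set.Ici 0)) {x : ℝ} (hx : 1 < x) :
    HasDerivAt (fun x => deriv Ψ (log x ^ 2 / 2) * (log x / x))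
      ((2 * (log x ^ 2 / 2) * deriv (deriv Ψ) (log x ^ 2 / 2) +
        (1 - √(2 * (log x ^ 2 / 2))) * deriv Ψ (log x ^ 2 / 2)) / x ^ 2) x := by
  have hl := Real.log_pos hx
  have hs : 0 < log x ^ 2 / 2 := by positivity
  have hx0 : x ≠ 0 := by positivity
  have h1 : HasDerivAt (deriv Ψ) (deriv (deriv Ψ) (log x ^ 2 / 2)) (log x ^ 2 / 2) := by
    have hC : ContDiffOn ℝ 2 Ψ (Set.Ioi 0) := hΨ.mono Set.Ioi_subset_Ici_self
    have hD : ContDiffOn ℝ 1 (deriv Ψ) (Set.Ioi 0) := hC.deriv_of_isOpen isOpen_Ioi (by norm_num)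
    exact ((hD.contDiffAt (Ioi_mem_nhds hs)).differentiableAt (by norm_num)).hasDerivAt
  have h2 := hasDerivAt_log_sq_div_two (by positivity : x ≠ 0)
  have h3 : HasDerivAt (fun x => log x / x) ((x⁻¹ * x - log x * 1) / x ^ 2) x :=
    (Real.hasDerivAt_log hx0).div (hasDerivAt_id x) hx0
  have hsq : √(2 * (log x ^ 2 / 2)) = log x := by
    rw [mul_div_cancel₀ _ two_ne_zero, Real.sqrt_sq hl.le]
  rw [hsq]
  refine ((h1.comp x h2).mul h3).congr_deriv ?_
  simp only [Function.comp]
  field_simp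

theorem deriv_inequality_of_convexOn (hΨ : ContDiffOn ℝ 2 Ψ (Set.Ici 0))
    (hc : ConvexOn ℝ (Set.Ioi 1) (fun x => Ψ (log x ^ 2 / 2))) {s : ℝ} (hs : 0 < s) :
    0 ≤ 2 * s * deriv (deriv Ψ) s + (1 - √(2 * s)) * deriv Ψ s := by
  have hu : 0 < √(2 * s) := by positivity
  set x := exp √(2 * s) with hx
  have hx1 : 1 < x := Real.one_lt_exp_iff.2 hu
  have hxs : log x ^ 2 / 2 = s := by
    rw [hx, Real.log_exp, Real.sq_sqrt (by positivity)]
    ring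
  have hmono : MonotoneOn (fun x => deriv Ψ (log x ^ 2 / 2) * (log x / x)) (Set.Ioi 1) := by
    refine (hc.monotoneOn_deriv fun y hy =>
      (hasDerivAt_comp_log_sq hΨ hy).differentiableAt).congr fun y hy => ?_
    exact (hasDerivAt_comp_log_sq hΨ hy).deriv
  have h0 := hmono.derivWithin_nonneg (x := x)
  have hd := hasDerivAt_deriv_comp_log_sq hΨ hx1
  rw [derivWithin_of_isOpen isOpen_Ioi hx1, hd.deriv, hxs] at h0
  have hx2 : 0 < x ^ 2 := by positivity
  simpa using (le_div_iff₀ hx2).1 h0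

theorem convexOn_and_monotoneOn_of_deriv_inequality (hΨ : ContDiffOn ℝ 2 Ψ (Set.Ici 0))
    (H : ∀ s : ℝ, 0 < s → 0 ≤ 2 * s * deriv (deriv Ψ) s + (1 - √(2 * s)) * deriv Ψ s) :
    ConvexOn ℝ (Set.Ici 1) (fun x => Ψ (log x ^ 2 / 2)) ∧
      MonotoneOn (fun x => Ψ (log x ^ 2 / 2)) (Set.Ici 1) := by
  have hlog : ContinuousOn log (Set.Ici 1) :=
    Real.continuousOn_log.mono fun x (hx : 1 ≤ x) => by
      simp only [Set.mem_compl_iff, Set.mem_singleton_iff]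
      positivity
  have hsq : ContinuousOn (fun x => log x ^ 2 / 2) (Set.Ici 1) := (hlog.pow 2).div_const 2
  have hmaps : Set.MapsTo (fun x => log x ^ 2 / 2) (Set.Ici 1) (Set.Ici 0) := fun x _ => by
    simp only [Set.mem_Ici]
    positivity
  have hcont : ContinuousOn (fun x => Ψ (log x ^ 2 / 2)) (Set.Ici 1) :=
    hΨ.continuousOn.comp hsq hmaps
  set g : ℝ → ℝ := fun x => derivWithin Ψ (Set.Ici 0) (log x ^ 2 / 2) * (log x / x) with hg
  have hgcont : ContinuousOn g (Set.Ici 1) := by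
    refine ((hΨ.continuousOn_derivWithin (uniqueDiffOn_Ici 0) (by norm_num)).comp hsq hmaps).mul
      (hlog.div continuousOn_id fun x (hx : 1 ≤ x) => ?_)
    positivity
  have hgeq : ∀ x, 1 < x → g x = deriv Ψ (log x ^ 2 / 2) * (log x / x) := by
    intro x hx
    have hs : 0 < log x ^ 2 / 2 := by have := Real.log_pos hx; positivity
    simp only [hg]
    rw [derivWithin_of_mem_nhds (Ici_mem_nhds hs)]
  have hgderiv : ∀ x, 1 < x → HasDerivAt g
      ((2 * (log x ^ 2 / 2) * deriv (deriv Ψ) (log x ^ 2 / 2) +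
        (1 - √(2 * (log x ^ 2 / 2))) * deriv Ψ (log x ^ 2 / 2)) / x ^ 2) x := by
    intro x hx
    refine (hasDerivAt_deriv_comp_log_sq hΨ hx).congr_of_eventuallyEq ?_
    filter_upwards [Ioi_mem_nhds hx] with y hy using hgeq y hy
  have hgmono : MonotoneOn g (Set.Ici 1) := by
    refine monotoneOn_of_deriv_nonneg (convex_Ici 1) hgcont ?_ ?_ <;> rw [interior_Ici]
    · exact fun x hx => (hgderiv x hx).differentiableAt.differentiableWithinAt
    · intro x (hx : 1 < x)
      rw [(hgderiv x hx).deriv]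
      have := Real.log_pos hx
      exact div_nonneg (H _ (by positivity)) (by positivity)
  have hderiv : ∀ x, 1 < x → HasDerivAt (fun x => Ψ (log x ^ 2 / 2)) (g x) x := fun x hx => by
    rw [hgeq x hx]
    exact hasDerivAt_comp_log_sq hΨ hx
  have hdiff : DifferentiableOn ℝ (fun x => Ψ (log x ^ 2 / 2)) (interior (Set.Ici 1)) := by
    rw [interior_Ici]
    exact fun x hx => (hderiv x hx).differentiableAt.differentiableWithinAt
  constructor
  · refine MonotoneOn.convexOn_of_deriv (convex_Ici 1) hcont hdiff ?_
    rw [interior_Ici]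
    exact (hgmono.mono Set.Ioi_subset_Ici_self).congr fun x hx => (hderiv x hx).deriv.symm
  · refine monotoneOn_of_deriv_nonneg (convex_Ici 1) hcont hdiff fun x hx => ?_
    rw [interior_Ici] at hx
    rw [(hderiv x hx).deriv]
    have h1 : g 1 = 0 := by simp [hg]
    exact h1 ▸ hgmono Set.self_mem_Ici (Set.Ioi_subset_Ici_self hx) (le_of_lt hx)

end Scalar

theorem RankOneConvex.convexOn_of_eq {W : Mat 2 → ℝ} {h : ℝ → ℝ} (hW : RankOneConvex W)
    (hWh : ∀ F ∈ GLp 2, W F = h (singMax F ^ 2 / F.det)) : ConvexOn ℝ (Set.Ioi 1) h := by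
  have hval : ∀ t : ℝ, 0 < t → 0 < ((1 : Mat 2) + t • vecMulVec ![1, 0] ![1, 0]).det ∧
      W (1 + t • vecMulVec ![1, 0] ![1, 0]) = h (1 + t) := by
    intro t ht
    have hF : (1 : Mat 2) + t • vecMulVec ![1, 0] ![1, 0] = !![1 + t, 0; 0, 1] := by
      ext i j
      fin_cases i <;> fin_cases j <;> simp
    have hdet : (!![1 + t, 0; 0, 1] : Mat 2).det = 1 + t := by simp [det_fin_two]
    have hmax : singMax !![1 + t, 0; 0, 1] = 1 + t := by
      have h1 : singSum !![1 + t, 0; 0, 1] = 1 + t + 1 := by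
        rw [← sq_eq_sq₀ (singSum_nonneg _) (by positivity), singSum_sq, hdet]
        simp [nsq, Matrix.trace, Matrix.mul_apply, Fin.sum_univ_two]
        ring
      have h2 : singDiff !![1 + t, 0; 0, 1] = t := by
        rw [← sq_eq_sq₀ (singDiff_nonneg _) ht.le, singDiff_sq, hdet]
        simp [nsq, Matrix.trace, Matrix.mul_apply, Fin.sum_univ_two]
        ring
      rw [singMax, h1, h2]
      ring
    have hpos : 0 < (!![1 + t, 0; 0, 1] : Mat 2).det := by rw [hdet]; positivity
    rw [hF]
    refine ⟨hpos, ?_⟩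
    rw [hWh _ hpos, hmax, hdet]
    congr 1
    field_simp
  have hc := hW 1 (by simp [GLp]) ![1, 0] ![1, 0] (Set.Ioi 0) (convex_Ioi 0)
    fun t ht => (hval t ht).1
  refine ⟨convex_Ioi 1, fun x hx y hy a b ha hb hab => ?_⟩
  have hx' : x - 1 ∈ Set.Ioi (0 : ℝ) := sub_pos.2 (Set.mem_Ioi.1 hx)
  have hy' : y - 1 ∈ Set.Ioi (0 : ℝ) := sub_pos.2 (Set.mem_Ioi.1 hy)
  have hxy := hc.2 hx' hy' ha hb hab
  simp only [(hval _ hx').2, (hval _ hy').2, (hval _ (hc.1 hx' hy' ha hb hab)).2,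
    add_sub_cancel] at hxy
  convert hxy using 2
  simp only [smul_eq_mul]
  linear_combination hab

/-- **Proposition 5.1.** For twice continuously differentiable `Ψ : [0,∞) → ℝ` and
`W(F) = Ψ(‖dev₂ log U‖²)` on `GL⁺(2)` (with `U = √(FᵀF)`), the following are equivalent:
(i) `W` is polyconvex; (ii) `W` is rank-one convex;
(iii) `2ηΨ''(η) + (1 − √(2η))Ψ'(η) ≥ 0` for all `η ∈ (0,∞)`. -/
theorem planar_rank_one_iff_polyconvex
    (Ψ : ℝ → ℝ) (hΨ : ContDiffOn ℝ 2 Ψ (Set.Ici 0))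
    (W : Mat 2 → ℝ) (hW : ∀ F : Mat 2, W F = Ψ (nsq (dev (logU F)))) :
    (Polyconvex2 W ↔ RankOneConvex W) ∧
    (RankOneConvex W ↔
      ∀ s : ℝ, 0 < s → 0 ≤ 2 * s * deriv (deriv Ψ) s + (1 - Real.sqrt (2 * s)) * deriv Ψ s) := by
  have hWh : ∀ F ∈ GLp 2, W F = Ψ (log (singMax F ^ 2 / F.det) ^ 2 / 2) := fun F hF => by
    rw [hW, nsq_dev_logU hF]
  have ineq_of_rankOne : RankOneConvex W →
      ∀ s : ℝ, 0 < s → 0 ≤ 2 * s * deriv (deriv Ψ) s + (1 - √(2 * s)) * deriv Ψ s :=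
    fun h s hs => deriv_inequality_of_convexOn hΨ
      (h.convexOn_of_eq (h := fun x => Ψ (log x ^ 2 / 2)) hWh) hs
  have poly_of_ineq : (∀ s : ℝ, 0 < s → 0 ≤ 2 * s * deriv (deriv Ψ) s + (1 - √(2 * s)) * deriv Ψ s) →
      Polyconvex2 W := fun H =>
    have hΨ' := convexOn_and_monotoneOn_of_deriv_inequality hΨ H
    polyconvex2_of_convexOn (h := fun x => Ψ (log x ^ 2 / 2)) hΨ'.1 hΨ'.2 hWh
  exact ⟨⟨Polyconvex2.rankOneConvex, fun h => poly_of_ineq (ineq_of_rankOne h)⟩,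
    ⟨ineq_of_rankOne, fun H => (poly_of_ineq H).rankOneConvex⟩⟩
end
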